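/- For any random vector (X, X̃^(1),…,X̃^(M)) with values in 𝒳^{M+1}, any measurable statistic T : 𝒳 → ℝ and any α ∈ [0,1], P(pval_T(X, X̃^(1),…,X̃^(M)) ≤ α) ≤ α + d_exch(X, X̃^(1),…,X̃^(M)). -/

import Mathlib

open MeasureTheory
open scoped ENNReal Classical

noncomputable section

namespace ACSS

/-- The aCSS p-value `pval_T(X, X̃⁽¹⁾, …, X̃⁽ᴹ⁾)`. -/
def pval {𝒳 : Type*} (T : 𝒳 → ℝ) {M : ℕ} (x : 𝒳) (xt : Fin M → 𝒳) : ℝ :=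
  (1 + (Finset.univ.filter fun m : Fin M => T x ≤ T (xt m)).card) / (M + 1)

/-- Total variation distance between two measures. -/
def dTV {β : Type*} [MeasurableSpace β] (μ ν : Measure β) : ℝ :=
  ⨆ s : {s : Set β // MeasurableSet s}, |(μ s).toReal - (ν s).toReal|

/-- A law on `Fin k → 𝒳` is exchangeable if it is invariant under all coordinate
permutations. -/
def IsExchangeable {𝒳 : Type*} [MeasurableSpace 𝒳] {k : ℕ} (μ : Measure (Fin k → 𝒳)) : Prop :=
  ∀ π : Equiv.Perm (Fin k), μ.map (· ∘ π) = μ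

/-- Distance to exchangeability: infimum of the TV distance to an exchangeable law. -/
def dExch {𝒳 : Type*} [MeasurableSpace 𝒳] {k : ℕ} (μ : Measure (Fin k → 𝒳)) : ℝ :=
  ⨅ ν : {ν : Measure (Fin k → 𝒳) // IsProbabilityMeasure ν ∧ IsExchangeable ν}, dTV μ ν

def rk {𝒳 : Type*} (T : 𝒳 → ℝ) {k : ℕ} (i : Fin k) (x : Fin k → 𝒳) : ℕ :=
  (Finset.univ.filter fun j : Fin k => T (x i) ≤ T (x j)).card

lemma pval_eq_rk {𝒳 : Type*} (T : 𝒳 → ℝ) {M : ℕ} (x : Fin (M + 1) → 𝒳) :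
    pval T (x 0) (fun m => x m.succ) = (rk T 0 x : ℝ) / (M + 1) := by
  unfold pval rk
  congr 1
  simp only [Finset.card_filter]
  rw [Fin.sum_univ_succ]
  simp

lemma rk_perm {𝒳 : Type*} (T : 𝒳 → ℝ) {k : ℕ} (i : Fin k) (x : Fin k → 𝒳)
    (π : Equiv.Perm (Fin k)) : rk T i (x ∘ π) = rk T (π i) x := by
  unfold rk
  simp only [Finset.card_filter, Function.comp]
  exact Equiv.sum_comp π (fun j => if T (x (π i)) ≤ T (x j) then 1 else 0)

lemma card_rk_le {𝒳 : Type*} (T : 𝒳 → ℝ) {k : ℕ} (x : Fin k → 𝒳) (c : ℝ) (hc : 0 ≤ c) :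
    ((Finset.univ.filter fun i : Fin k => (rk T i x : ℝ) ≤ c).card : ℝ) ≤ c := by
  rcases (Finset.univ.filter fun i : Fin k => (rk T i x : ℝ) ≤ c).eq_empty_or_nonempty with h | h
  · rw [h]; simpa using hc
  · obtain ⟨i, hi, hmin⟩ := Finset.exists_min_image _ (fun i => T (x i)) h
    refine le_trans ?_ (Finset.mem_filter.1 hi).2
    unfold rk
    exact_mod_cast Finset.card_le_card fun j hj => by
      simpa using hmin j hj

lemma measurable_rk {𝒳 : Type*} [MeasurableSpace 𝒳] (T : 𝒳 → ℝ) (hT : Measurable T) {k : ℕ}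
    (i : Fin k) : Measurable (fun x : Fin k → 𝒳 => (rk T i x : ℝ)) := by
  unfold rk
  simp only [Finset.card_filter, Nat.cast_sum]
  refine Finset.measurable_sum _ fun j _ => ?_
  have : MeasurableSet {x : Fin k → 𝒳 | T (x i) ≤ T (x j)} :=
    measurableSet_le (hT.comp (measurable_pi_apply i)) (hT.comp (measurable_pi_apply j))
  simp only [Nat.cast_ite]
  exact Measurable.ite this measurable_const measurable_const

lemma exch_bound {𝒳 : Type*} [MeasurableSpace 𝒳] {M : ℕ} (ν : Measure (Fin (M + 1) → 𝒳))
    [IsProbabilityMeasure ν] (hν : IsExchangeable ν) (T : 𝒳 → ℝ) (hT : Measurable T)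
    (α : ℝ) (hα : 0 ≤ α) :
    ν.real {x | (rk T 0 x : ℝ) ≤ α * (M + 1)} ≤ α := by
  set S : Fin (M + 1) → Set (Fin (M + 1) → 𝒳) := fun i => {x | (rk T i x : ℝ) ≤ α * (M + 1)}
    with hS
  have hm : ∀ i, MeasurableSet (S i) := fun i =>
    measurableSet_le (measurable_rk T hT i) measurable_const
  have heq : ∀ i, ν.real (S i) = ν.real (S 0) := by
    intro i
    have hpm : Measurable (fun x : Fin (M + 1) → 𝒳 => x ∘ (Equiv.swap 0 i)) :=
      measurable_pi_lambda _ fun j => measurable_pi_apply _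
    conv_rhs => rw [← hν (Equiv.swap 0 i)]
    rw [map_measureReal_apply hpm (hm 0)]
    congr 1
    ext x
    simp [hS, rk_perm]
  have hsum : ∑ i, ν.real (S i) ≤ α * (M + 1) := by
    have h1 : ∀ i, ν.real (S i) = ∫ x, (S i).indicator (fun _ => (1 : ℝ)) x ∂ν := by
      intro i
      rw [integral_indicator_const _ (hm i)]; simp
    have hi : ∀ i, Integrable (fun x => (S i).indicator (fun _ => (1 : ℝ)) x) ν := fun i =>
      (integrable_const 1).indicator (hm i)
    simp_rw [h1]
    rw [← integral_finset_sum _ fun i _ => hi i]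
    calc _ ≤ ∫ x, α * (M + 1) ∂ν := by
          refine integral_mono (integrable_finset_sum _ fun i _ => hi i) (integrable_const _) ?_
          intro x
          have := card_rk_le T x (α * (M + 1)) (by positivity)
          simp only [Finset.card_filter, Nat.cast_sum] at this
          simpa [Set.indicator_apply, hS] using this
      _ = _ := by simp
  simp_rw [heq] at hsum
  simp only [Finset.sum_const, Finset.card_univ, Fintype.card_fin, nsmul_eq_mul] at hsum
  push_cast at hsum
  have : (0 : ℝ) < M + 1 := by positivity
  change ν.real (S 0) ≤ α
  nlinarith

lemma le_dTV {β : Type*} [MeasurableSpace β] (μ ν : Measure β) [IsProbabilityMeasure μ]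
    [IsProbabilityMeasure ν] (s : Set β) (hs : MeasurableSet s) :
    μ.real s - ν.real s ≤ dTV μ ν := by
  refine le_trans (le_abs_self _) ?_
  refine le_ciSup (f := fun s : {s : Set β // MeasurableSet s} =>
    |(μ s).toReal - (ν s).toReal|) ⟨1, ?_⟩ ⟨s, hs⟩
  rintro _ ⟨t, rfl⟩
  have h1 : μ.real t ≤ 1 := measureReal_le_one
  have h2 : ν.real t ≤ 1 := measureReal_le_one
  have h3 : 0 ≤ μ.real t := measureReal_nonneg
  have h4 : 0 ≤ ν.real t := measureReal_nonneg
  change |μ.real t - ν.real t| ≤ 1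
  rw [abs_le]; constructor <;> linarith

/-- For any random vector `(X, X̃⁽¹⁾, …, X̃⁽ᴹ⁾)`, any measurable statistic `T` and any
`α ∈ [0,1]`: `P(pval_T ≤ α) ≤ α + d_exch(X, X̃⁽¹⁾, …, X̃⁽ᴹ⁾)`. -/
theorem pval_bound_of_dExch
    {𝒳 : Type*} [MeasurableSpace 𝒳] {M : ℕ}
    {Ω : Type*} [MeasurableSpace Ω] (P : Measure Ω) [IsProbabilityMeasure P]
    (X : Ω → 𝒳) (Xt : Fin M → Ω → 𝒳)
    (hX : Measurable X) (hXt : ∀ m, Measurable (Xt m))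
    (T : 𝒳 → ℝ) (hT : Measurable T) (α : ℝ) (hα : α ∈ Set.Icc (0 : ℝ) 1) :
    (P {ω | pval T (X ω) (fun m => Xt m ω) ≤ α}).toReal ≤
      α + dExch (P.map fun ω => (Fin.cons (X ω) fun m => Xt m ω : Fin (M + 1) → 𝒳)) := by
  have hY : Measurable (fun ω => (Fin.cons (X ω) fun m => Xt m ω : Fin (M + 1) → 𝒳)) := by
    refine measurable_pi_lambda _ fun j => ?_
    refine Fin.cases ?_ (fun m => ?_) j
    · simpa using hX
    · simpa using hXt m
  set Y := fun ω => (Fin.cons (X ω) fun m => Xt m ω : Fin (M + 1) → 𝒳) with hYd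
  have : IsProbabilityMeasure (P.map Y) := Measure.isProbabilityMeasure_map hY.aemeasurable
  have hS : MeasurableSet {x : Fin (M + 1) → 𝒳 | (rk T 0 x : ℝ) ≤ α * (M + 1)} :=
    measurableSet_le (measurable_rk T hT 0) measurable_const
  have hP : (P {ω | pval T (X ω) (fun m => Xt m ω) ≤ α}).toReal =
      (P.map Y).real {x | (rk T 0 x : ℝ) ≤ α * (M + 1)} := by
    rw [map_measureReal_apply hY hS]
    change P.real _ = _
    congr 1
    ext ω
    have := pval_eq_rk T (Y ω)
    simp only [hYd, Fin.cons_zero, Fin.cons_succ] at this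
    simp only [Set.mem_setOf_eq, Set.mem_preimage]
    rw [this, div_le_iff₀ (by positivity)]
  rw [hP, ← sub_le_iff_le_add']
  obtain ⟨ω₀⟩ : Nonempty Ω := nonempty_of_isProbabilityMeasure P
  have hne : Nonempty {ν : Measure (Fin (M + 1) → 𝒳) //
      IsProbabilityMeasure ν ∧ IsExchangeable ν} := by
    refine ⟨Measure.dirac (fun _ => X ω₀), inferInstance, fun π => ?_⟩
    have hpm : Measurable (fun x : Fin (M + 1) → 𝒳 => x ∘ π) :=
      measurable_pi_lambda _ fun j => measurable_pi_apply _
    rw [Measure.map_dirac' hpm]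
    rfl
  refine le_ciInf fun ν => ?_
  obtain ⟨ν, hp, he⟩ := ν
  have h1 := exch_bound ν he T hT α hα.1
  have h2 := le_dTV (P.map Y) ν _ hS
  change _ ≤ dTV (P.map Y) ν
  linarith

end ACSS
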